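/- Let K be a compact metric space, f a Baire class one function on K, β₀ ≥ 1 a countable ordinal and γ₀ a countable ordinal with β(f) ≤ β₀·ω^{γ₀}. Then there exists a sequence (fₙ) of Baire class one functions on K converging pointwise to f with β(fₙ) ≤ β₀ for all n and γ((fₙ)) ≤ ω^{γ₀}. -/

import Mathlib

open Filter Topology Set Ordinal

noncomputable section

/-- One step of the oscillation derivation of `A` with respect to `f` and `ε`. -/
def oscStep {K : Type*} [TopologicalSpace K] (f : K → ℝ) (ε : ℝ) (A : Set K) : Set K :=
  {x ∈ A | ∀ U : Set K, IsOpen U → x ∈ U →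
    ∃ x₁ ∈ U ∩ A, ∃ x₂ ∈ U ∩ A, ε ≤ |f x₁ - f x₂|}

/-- The transfinite oscillation derivatives `H^α(f, ε)`. -/
def oscDeriv {K : Type*} [TopologicalSpace K] (f : K → ℝ) (ε : ℝ) (H : Set K) :
    Ordinal → Set K := fun α =>
  Ordinal.limitRecOn α H (fun _ ih => oscStep f ε ih)
    (fun _ _ ih => ⋂ (β : Ordinal) (h : _), ih β h)

/-- One step of the convergence derivation of `A` for a sequence `f`. -/
def seqStep {K : Type*} [TopologicalSpace K] (f : ℕ → K → ℝ) (ε : ℝ) (A : Set K) : Set K :=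
  {x ∈ A | ∀ U : Set K, IsOpen U → x ∈ U → ∀ m : ℕ,
    ∃ n₁ n₂ : ℕ, m < n₂ ∧ n₂ < n₁ ∧ ∃ x' ∈ U ∩ A, ε ≤ |f n₁ x' - f n₂ x'|}

/-- The transfinite convergence derivatives `H^α((fₙ), ε)`. -/
def seqDeriv {K : Type*} [TopologicalSpace K] (f : ℕ → K → ℝ) (ε : ℝ) (H : Set K) :
    Ordinal → Set K := fun α =>
  Ordinal.limitRecOn α H (fun _ ih => seqStep f ε ih)
    (fun _ _ ih => ⋂ (β : Ordinal) (h : _), ih β h)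

open Classical in
/-- The least ordinal at which the family `S` is empty, and `ω₁` if there is none. -/
def emptyIndex {K : Type*} (S : Ordinal → Set K) : Ordinal :=
  if _ : ∃ α, S α = ∅ then sInf {α | S α = ∅} else (Cardinal.aleph 1).ord

/-- The oscillation index `β_H(f, ε)`. -/
def betaEpsOn {K : Type*} [TopologicalSpace K] (f : K → ℝ) (ε : ℝ) (H : Set K) : Ordinal :=
  emptyIndex (oscDeriv f ε H)

/-- The oscillation index `β_H(f)`. -/
def betaOn {K : Type*} [TopologicalSpace K] (f : K → ℝ) (H : Set K) : Ordinal :=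
  ⨆ ε : {e : ℝ // 0 < e}, betaEpsOn f ε.1 H

/-- The oscillation index `β(f)` over the whole space. -/
def beta {K : Type*} [TopologicalSpace K] (f : K → ℝ) : Ordinal :=
  betaOn f Set.univ

/-- The convergence index `γ_H((fₙ), ε)`. -/
def gammaEpsOn {K : Type*} [TopologicalSpace K] (f : ℕ → K → ℝ) (ε : ℝ) (H : Set K) : Ordinal :=
  emptyIndex (seqDeriv f ε H)

/-- The convergence index `γ_H((fₙ))`. -/
def gammaOn {K : Type*} [TopologicalSpace K] (f : ℕ → K → ℝ) (H : Set K) : Ordinal :=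
  ⨆ ε : {e : ℝ // 0 < e}, gammaEpsOn f ε.1 H

/-- The convergence index `γ((fₙ))` over the whole space. -/
def gamma {K : Type*} [TopologicalSpace K] (f : ℕ → K → ℝ) : Ordinal :=
  gammaOn f Set.univ

/-- A function is of Baire class one if it is a pointwise limit of continuous functions. -/
def BaireOne {K : Type*} [TopologicalSpace K] (f : K → ℝ) : Prop :=
  ∃ F : ℕ → K → ℝ, (∀ n, Continuous (F n)) ∧
    ∀ x, Tendsto (fun n => F n x) atTop (nhds (f x))

/-- `f` is of Baire class one on the subspace `F`. -/
def BaireOneOn {K : Type*} [TopologicalSpace K] (f : K → ℝ) (F : Set K) : Prop :=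
  ∃ g : ℕ → F → ℝ, (∀ n, Continuous (g n)) ∧
    ∀ x : F, Tendsto (fun n => g n x) atTop (nhds (f x))

/-- `g` is a convex block combination of `f`. -/
def ConvexBlockOf {K : Type*} (g f : ℕ → K → ℝ) : Prop :=
  ∃ a : ℕ → ℝ, ∃ p : ℕ → ℕ, (∀ k, 0 ≤ a k) ∧ StrictMono p ∧ p 0 = 0 ∧
    (∀ n, ∑ k ∈ Finset.Ioc (p n) (p (n + 1)), a k = 1) ∧
    ∀ n x, g n x = ∑ k ∈ Finset.Ioc (p n) (p (n + 1)), a k * f k x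

end

universe v

noncomputable def hsum (a b : Ordinal.{v}) : Ordinal.{v} :=
  max (⨆ x : Iio a, (hsum x.1 b + 1)) (⨆ x : Iio b, (hsum a x.1 + 1))
termination_by (a, b)
decreasing_by
  · exact Prod.Lex.left _ _ x.2
  · exact Prod.Lex.right _ x.2

theorem hsum_lt_left {a a' b : Ordinal.{v}} (h : a' < a) : hsum a' b < hsum a b := by
  rw [hsum.eq_1 a b]
  refine lt_of_lt_of_le ?_ (le_max_left _ _)
  refine lt_of_lt_of_le (Order.lt_add_one_iff.2 le_rfl) ?_
  exact Ordinal.le_iSup (fun x : Iio a => hsum x.1 b + 1) ⟨a', h⟩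

theorem hsum_lt_right {a b b' : Ordinal.{v}} (h : b' < b) : hsum a b' < hsum a b := by
  rw [hsum.eq_1 a b]
  refine lt_of_lt_of_le ?_ (le_max_right _ _)
  refine lt_of_lt_of_le (Order.lt_add_one_iff.2 le_rfl) ?_
  exact Ordinal.le_iSup (fun x : Iio b => hsum a x.1 + 1) ⟨b', h⟩

theorem hsum_le_iff {a b c : Ordinal.{v}} :
    hsum a b ≤ c ↔ (∀ x < a, hsum x b < c) ∧ (∀ x < b, hsum a x < c) := by
  constructor
  · intro h
    exact ⟨fun x hx => (hsum_lt_left hx).trans_le h, fun x hx => (hsum_lt_right hx).trans_le h⟩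
  · rintro ⟨h1, h2⟩
    rw [hsum.eq_1 a b]
    refine max_le (Ordinal.iSup_le fun x => ?_) (Ordinal.iSup_le fun x => ?_)
    · exact Order.add_one_le_iff.2 (h1 _ x.2)
    · exact Order.add_one_le_iff.2 (h2 _ x.2)

theorem hsum_mono {a a' b b' : Ordinal.{v}} (h : a' ≤ a) (h' : b' ≤ b) :
    hsum a' b' ≤ hsum a b := by
  have h1 : hsum a' b' ≤ hsum a b' := by
    rcases h.eq_or_lt with rfl | h
    · exact le_rfl
    · exact (hsum_lt_left h).le
  have h2 : hsum a b' ≤ hsum a b := by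
    rcases h'.eq_or_lt with rfl | h
    · exact le_rfl
    · exact (hsum_lt_right h).le
  exact h1.trans h2

theorem hsum_eq {a a' b b' : Ordinal.{v}} (h : a' ≤ a) (h' : b' ≤ b)
    (he : hsum a' b' = hsum a b) : a' = a ∧ b' = b := by
  constructor
  · by_contra hne
    exact absurd he ((hsum_lt_left (lt_of_le_of_ne h hne)).trans_le (hsum_mono le_rfl h')).ne
  · by_contra hne
    exact absurd he ((hsum_lt_right (lt_of_le_of_ne h' hne)).trans_le (hsum_mono h le_rfl)).ne

theorem hsum_lt_aux (c : Ordinal.{v})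
    (IH : ∀ a < ω ^ c, ∀ b < ω ^ c, hsum a b < ω ^ c) :
    ∀ a b : Ordinal.{v}, ∀ m n : ℕ, ∀ a' < ω ^ c, ∀ b' < ω ^ c,
      a = ω ^ c * m + a' → b = ω ^ c * n + b' →
      hsum a b ≤ ω ^ c * ((m + n : ℕ) : Ordinal) + hsum a' b' := by
  have hc : (ω ^ c : Ordinal.{v}) ≠ 0 := (opow_pos _ omega0_pos).ne'
  have key : ∀ (m : ℕ) (x a' : Ordinal.{v}), x < ω ^ c * m + a' → a' < ω ^ c →
      ∃ k : ℕ, ∃ x' < ω ^ c, x = ω ^ c * k + x' ∧ (k < m ∨ (k = m ∧ x' < a')) := by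
    intro m x a' hx ha'
    have h1 : x / ω ^ c ≤ m := by
      rw [Ordinal.div_le hc, Order.succ_eq_add_one, mul_add, mul_one]
      exact hx.trans (by gcongr)
    obtain ⟨k, hk⟩ := lt_omega0.1 (h1.trans_lt (natCast_lt_omega0 m))
    refine ⟨k, x % ω ^ c, mod_lt _ hc, ?_, ?_⟩
    · rw [← hk, div_add_mod]
    · rw [hk] at h1
      have h1' : k ≤ m := by exact_mod_cast h1
      rcases h1'.lt_or_eq with h | h
      · exact Or.inl h
      · refine Or.inr ⟨h, ?_⟩
        rw [← div_add_mod x (ω ^ c), hk, h] at hx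
        exact lt_of_add_lt_add_left hx
  have step : ∀ (p q : ℕ) (u w : Ordinal.{v}), u < ω ^ c → p < q →
      ω ^ c * (p : Ordinal) + u < ω ^ c * (q : Ordinal) + w := by
    intro p q u w hu hpq
    calc ω ^ c * (p : Ordinal) + u < ω ^ c * (p : Ordinal) + ω ^ c := by gcongr
      _ = ω ^ c * ((p + 1 : ℕ) : Ordinal) := by push_cast; rw [mul_add, mul_one]
      _ ≤ ω ^ c * (q : Ordinal) := by
        gcongr
        exact_mod_cast hpq
      _ ≤ _ := le_self_add
  intro a
  induction a using WellFoundedLT.induction with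
  | ind a iha =>
  intro b
  induction b using WellFoundedLT.induction with
  | ind b ihb =>
  intro m n a' ha' b' hb' hea heb
  rw [hsum_le_iff]
  constructor
  · intro x hx
    obtain ⟨k, x', hx', hxe, hk⟩ := key m x a' (hea ▸ hx) ha'
    refine (iha x hx b k n x' hx' b' hb' hxe heb).trans_lt ?_
    rcases hk with hk | ⟨rfl, hk⟩
    · exact step _ _ _ _ (IH _ hx' _ hb') (by omega)
    · have := hsum_lt_left (b := b') hk
      gcongr
  · intro x hx
    obtain ⟨k, x', hx', hxe, hk⟩ := key n x b' (heb ▸ hx) hb'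
    refine (ihb x hx m k a' ha' x' hx' hea hxe).trans_lt ?_
    rcases hk with hk | ⟨rfl, hk⟩
    · exact step _ _ _ _ (IH _ ha' _ hx') (by omega)
    · have := hsum_lt_right (a := a') hk
      gcongr

theorem hsum_lt (c : Ordinal.{v}) : ∀ a < ω ^ c, ∀ b < ω ^ c, hsum a b < ω ^ c := by
  induction c using Ordinal.limitRecOn with
  | zero =>
    intro a ha b hb
    simp only [opow_zero, Order.lt_one_iff] at *
    subst ha; subst hb
    rw [← nonpos_iff_eq_zero, hsum_le_iff]
    simp
  | add_one c IH =>
    intro a ha b hb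
    have hc : (ω ^ c : Ordinal.{v}) ≠ 0 := (opow_pos _ omega0_pos).ne'
    rw [← Order.succ_eq_add_one, opow_succ] at *
    obtain ⟨m, hm⟩ := lt_omega0.1 ((Ordinal.lt_mul_iff_div_lt hc).1 ha)
    obtain ⟨n, hn⟩ := lt_omega0.1 ((Ordinal.lt_mul_iff_div_lt hc).1 hb)
    have := hsum_lt_aux c IH a b m n _ (mod_lt a hc) _ (mod_lt b hc)
      (by rw [← hm, div_add_mod]) (by rw [← hn, div_add_mod])
    refine this.trans_lt ?_
    calc _ < ω ^ c * ((m + n : ℕ) : Ordinal) + ω ^ c := by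
            have := IH _ (mod_lt a hc) _ (mod_lt b hc)
            gcongr
      _ = ω ^ c * ((m + n + 1 : ℕ) : Ordinal) := by
            rw [Nat.cast_add (m + n) 1, Nat.cast_one, mul_add, mul_one]
      _ ≤ ω ^ c * ω := by
            gcongr
            exact (natCast_lt_omega0 _).le
  | limit c hc IH =>
    intro a ha b hb
    obtain ⟨x, hx, hax⟩ := (lt_opow_of_isSuccLimit omega0_ne_zero hc).1 ha
    obtain ⟨y, hy, hby⟩ := (lt_opow_of_isSuccLimit omega0_ne_zero hc).1 hb
    have hz : max x y < c := max_lt hx hy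
    have h1 : (ω ^ x : Ordinal.{v}) ≤ ω ^ (max x y) :=
      opow_le_opow_right omega0_pos (le_max_left _ _)
    have h2 : (ω ^ y : Ordinal.{v}) ≤ ω ^ (max x y) :=
      opow_le_opow_right omega0_pos (le_max_right _ _)
    exact (IH _ hz a (hax.trans_le h1) b (hby.trans_le h2)).trans_le
      (opow_le_opow_right omega0_pos hz.le)

theorem exists_opow_le (β γ : Ordinal.{v}) (hβ : 1 ≤ β) (hγ : γ ≠ 0) :
    ∃ a, ω ^ a ≤ β ∧ β * ω ^ γ ≤ ω ^ (a + γ) := by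
  have hb : β ≠ 0 := (zero_lt_one.trans_le hβ).ne'
  refine ⟨log ω β, opow_log_le_self _ hb, ?_⟩
  have h1 : β < ω ^ (log ω β + 1) := by
    simpa using lt_opow_succ_log_self one_lt_omega0 β
  have h2 : β * ω ≤ ω ^ (log ω β + 1) := by
    rw [mul_le_iff_of_isSuccLimit isSuccLimit_omega0]
    intro n hn
    exact (mul_lt_omega0_opow (by simp) h1 hn).le
  obtain ⟨δ, rfl⟩ : ∃ δ, γ = 1 + δ :=
    ⟨γ - 1, (Ordinal.add_sub_cancel_of_le (Order.one_le_iff_pos.2 (pos_iff_ne_zero.2 hγ))).symm⟩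
  rw [opow_add, opow_one, ← mul_assoc, ← add_assoc, opow_add]
  gcongr

section Derivatives

variable {K : Type*}

/-- Generic transfinite derivative. -/
noncomputable def gder (S : Set K → Set K) (H : Set K) (α : Ordinal.{v}) : Set K :=
  Ordinal.limitRecOn α H (fun _ ih => S ih) (fun _ _ ih => ⋂ (β : Ordinal) (h : _), ih β h)

theorem gder_zero (S : Set K → Set K) (H : Set K) : gder S H (0 : Ordinal.{v}) = H :=
  Ordinal.limitRecOn_zero ..

theorem gder_add_one (S : Set K → Set K) (H : Set K) (α : Ordinal.{v}) :
    gder S H (α + 1) = S (gder S H α) :=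
  Ordinal.limitRecOn_add_one ..

theorem gder_limit (S : Set K → Set K) (H : Set K) (α : Ordinal.{v}) (h : Order.IsSuccLimit α) :
    gder S H α = ⋂ (β : Ordinal) (_ : β < α), gder S H β :=
  Ordinal.limitRecOn_limit _ _ _ _ h

theorem gder_anti (S : Set K → Set K) (hS : ∀ A, S A ⊆ A) (H : Set K) (β : Ordinal.{v}) :
    ∀ α ≤ β, gder S H β ⊆ gder S H α := by
  induction β using Ordinal.limitRecOn with
  | zero => intro α h; rw [nonpos_iff_eq_zero.1 h]
  | add_one β IH =>
    intro α h
    rcases h.lt_or_eq with h | rfl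
    · rw [gder_add_one]
      exact (hS _).trans (IH α (Order.lt_add_one_iff.1 h))
    · exact subset_rfl
  | limit β hβ _ =>
    intro α h
    rcases h.lt_or_eq with h | rfl
    · rw [gder_limit _ _ _ hβ]
      exact iInter₂_subset α h
    · exact subset_rfl

theorem gder_rank (S : Set K → Set K) (hS : ∀ A, S A ⊆ A) (r : K → Ordinal.{v})
    (hr : ∀ (A : Set K), ∀ x ∈ A, (∀ y ∈ A, r x ≤ r y) → x ∉ S A) (α : Ordinal.{v}) :
    ∀ x ∈ gder S univ α, α ≤ r x := by
  induction α using Ordinal.limitRecOn with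
  | zero => intro x _; exact zero_le
  | add_one α IH =>
    intro x hx
    rw [gder_add_one] at hx
    have hx' := hS _ hx
    rcases (IH x hx').lt_or_eq with h | h
    · exact Order.add_one_le_iff.2 h
    · exact absurd hx (hr _ x hx' fun y hy => h ▸ IH y hy)
  | limit α hα IH =>
    intro x hx
    rw [gder_limit _ _ _ hα] at hx
    rw [hα.le_iff_forall_le]
    intro b hb
    exact IH b hb x (mem_iInter₂.1 hx b hb)

theorem emptyIndex_le {S : Ordinal.{v} → Set K} {α : Ordinal.{v}} (h : S α = ∅) :
    emptyIndex S ≤ α := by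
  unfold emptyIndex
  rw [dif_pos ⟨α, h⟩]
  exact csInf_le' h

theorem emptyIndex_exists {S : Ordinal.{v} → Set K} {α : Ordinal.{v}}
    (hα : α < (Cardinal.aleph 1).ord) (h : emptyIndex S ≤ α) : ∃ κ ≤ α, S κ = ∅ := by
  unfold emptyIndex at h
  split_ifs at h with h1
  · exact ⟨_, h, csInf_mem (s := {α | S α = ∅}) h1⟩
  · exact absurd h hα.not_ge

variable [TopologicalSpace K]

theorem beta_le (f : K → ℝ) (α : Ordinal.{v})
    (h : ∀ ε > 0, ∃ r : K → Ordinal.{v}, (∀ x, r x < α) ∧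
      ∀ x, ∀ᶠ y in 𝓝 x, r y ≤ r x ∧ (r y = r x → |f y - f x| < ε)) : beta f ≤ α := by
  unfold beta betaOn
  refine ciSup_le' fun ε => ?_
  obtain ⟨r, hr, hr2⟩ := h (ε.1 / 2) (half_pos ε.2)
  refine emptyIndex_le ?_
  rw [eq_empty_iff_forall_notMem]
  intro x hx
  refine absurd (hr x) (not_lt.2 ?_)
  refine gder_rank (oscStep f ε.1) (fun A => sep_subset _ _) r ?_ α x hx
  intro A x hxA hmin hx
  obtain ⟨U, hU, hUo, hxU⟩ := eventually_nhds_iff.1 (hr2 x)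
  obtain ⟨y, ⟨hyU, hyA⟩, z, ⟨hzU, hzA⟩, hyz⟩ := hx.2 U hUo hxU
  have h1 := (hU y hyU).2 (le_antisymm (hU y hyU).1 (hmin y hyA))
  have h2 := (hU z hzU).2 (le_antisymm (hU z hzU).1 (hmin z hzA))
  rw [abs_lt] at h1 h2
  have : |f y - f z| < ε.1 := by rw [abs_lt]; constructor <;> linarith
  linarith

theorem gamma_le (f : ℕ → K → ℝ) (α : Ordinal.{v})
    (h : ∀ ε > 0, ∃ r : K → Ordinal.{v}, (∀ x, r x < α) ∧
      ∀ x, ∃ m : ℕ, ∀ᶠ y in 𝓝 x, r y ≤ r x ∧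
        (r y = r x → ∀ n₁ > m, ∀ n₂ > m, |f n₁ y - f n₂ y| < ε)) : _root_.gamma f ≤ α := by
  change gammaOn f univ ≤ α
  unfold gammaOn
  refine ciSup_le' fun ε => ?_
  obtain ⟨r, hr, hr2⟩ := h ε.1 ε.2
  refine emptyIndex_le ?_
  rw [eq_empty_iff_forall_notMem]
  intro x hx
  refine absurd (hr x) (not_lt.2 ?_)
  refine gder_rank (seqStep f ε.1) (fun A => sep_subset _ _) r ?_ α x hx
  intro A x hxA hmin hx
  obtain ⟨m, hm⟩ := hr2 x
  obtain ⟨U, hU, hUo, hxU⟩ := eventually_nhds_iff.1 hm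
  obtain ⟨n₁, n₂, h2, h1, y, ⟨hyU, hyA⟩, hy⟩ := hx.2 U hUo hxU m
  have := (hU y hyU).2 (le_antisymm (hU y hyU).1 (hmin y hyA)) n₁ (h2.trans h1) n₂ h2
  linarith

theorem exists_osc_rank (f : K → ℝ) (α : Ordinal.{v}) (hα : α < (Cardinal.aleph 1).ord)
    (hf : beta f ≤ α) (ε : ℝ) (hε : 0 < ε) :
    ∃ r : K → Ordinal.{v}, (∀ x, r x < α) ∧
      ∀ x, ∀ᶠ y in 𝓝 x, r y ≤ r x ∧ (r y = r x → |f y - f x| < ε) := by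
  have h1 : betaEpsOn.{_, v} f ε univ ≤ α :=
    le_trans (Ordinal.le_iSup (fun e : {e : ℝ // 0 < e} => betaEpsOn.{_, v} f e.1 univ) ⟨ε, hε⟩) hf
  obtain ⟨κ, hκ, hκe⟩ := emptyIndex_exists hα h1
  change gder (oscStep f ε) univ κ = ∅ at hκe
  set D : Ordinal.{v} → Set K := gder (oscStep f ε) univ with hD
  have hsub : ∀ A, oscStep f ε A ⊆ A := fun A => sep_subset _ _
  have hanti : ∀ a b : Ordinal.{v}, a ≤ b → D b ⊆ D a :=
    fun a b hab => gder_anti _ hsub _ b a hab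
  have hne : ∀ x, {η : Ordinal.{v} | x ∉ D (η + 1)}.Nonempty := by
    intro x
    refine ⟨κ, fun hx => ?_⟩
    have := hanti κ (κ + 1) le_self_add hx
    rw [hκe] at this
    exact this
  let r : K → Ordinal.{v} := fun x => sInf {η : Ordinal.{v} | x ∉ D (η + 1)}
  have hr1 : ∀ x, x ∉ D (r x + 1) := fun x => csInf_mem (hne x)
  have hr3 : ∀ x η, x ∉ D (η + 1) → r x ≤ η := fun x η h => csInf_le' h
  have hr2 : ∀ x, x ∈ D (r x) := by
    intro x
    have hlt : ∀ η < r x, x ∈ D (η + 1) := by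
      intro η hη
      by_contra hc
      exact absurd (hr3 x η hc) (not_le.2 hη)
    rcases Ordinal.zero_or_succ_or_isSuccLimit (r x) with h | ⟨η, h⟩ | h
    · rw [h, hD, gder_zero]; trivial
    · rw [← h, Order.succ_eq_add_one]
      exact hlt η (by rw [← h]; exact Order.lt_succ η)
    · rw [hD, gder_limit _ _ _ h]
      refine mem_iInter₂.2 fun η hη => ?_
      exact hanti η (η + 1) le_self_add (hlt η hη)
  refine ⟨r, fun x => ?_, fun x => ?_⟩
  · refine lt_of_lt_of_le ?_ hκ
    by_contra hc
    have := hanti _ _ (not_lt.1 hc) (hr2 x)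
    rw [hκe] at this
    exact this
  · have h := hr1 x
    rw [hD, gder_add_one, ← hD] at h
    have h' : ∃ U : Set K, IsOpen U ∧ x ∈ U ∧ ∀ y ∈ U ∩ D (r x), ∀ z ∈ U ∩ D (r x),
        |f y - f z| < ε := by
      by_contra hc
      push Not at hc
      exact h ⟨hr2 x, fun U hU hx => hc U hU hx⟩
    obtain ⟨U, hUo, hxU, hU⟩ := h'
    filter_upwards [hUo.mem_nhds hxU] with y hy
    constructor
    · refine hr3 _ _ fun hy' => ?_
      rw [hD, gder_add_one, ← hD] at hy'
      obtain ⟨a, ha, b, hb, hab⟩ := hy'.2 U hUo hy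
      exact absurd (hU a ha b hb) (not_lt.2 hab)
    · intro he
      exact hU y ⟨hy, he ▸ hr2 y⟩ x ⟨hxU, hr2 x⟩

/-- `h` is continuous on the level sets of the upper semicontinuous rank `t`. -/
def LC (h : K → ℝ) (t : K → Ordinal.{v}) : Prop :=
  ∀ x, ∀ δ > 0, ∀ᶠ y in 𝓝 x, t y ≤ t x ∧ (t y = t x → |h y - h x| < δ)

theorem LC.add {h h' : K → ℝ} {t t' : K → Ordinal.{v}} (H : LC h t) (H' : LC h' t') :
    LC (fun x => h x + h' x) (fun x => hsum (t x) (t' x)) := by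
  intro x δ hδ
  filter_upwards [H x (δ / 2) (half_pos hδ), H' x (δ / 2) (half_pos hδ)] with y h1 h2
  refine ⟨hsum_mono h1.1 h2.1, fun he => ?_⟩
  obtain ⟨e1, e2⟩ := hsum_eq h1.1 h2.1 he
  have a1 := abs_lt.1 (h1.2 e1)
  have a2 := abs_lt.1 (h2.2 e2)
  rw [abs_lt]
  constructor <;> linarith

theorem LC.neg {h : K → ℝ} {t : K → Ordinal.{v}} (H : LC h t) :
    LC (fun x => - h x) t := by
  intro x δ hδ
  filter_upwards [H x δ hδ] with y h1
  refine ⟨h1.1, fun he => ?_⟩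
  have := h1.2 he
  rwa [← abs_neg, show -(-h y - -h x) = h y - h x by ring]

end Derivatives

section Metric

variable {K : Type*} [MetricSpace K]

theorem exists_LC_approx (f : K → ℝ) (ε : ℝ) (r : K → Ordinal.{v})
    (hr : ∀ x, ∀ᶠ y in 𝓝 x, r y ≤ r x ∧ (r y = r x → |f y - f x| < ε)) :
    ∃ g : K → ℝ, LC g r ∧ ∀ x, |g x - f x| ≤ ε := by
  have key : ∀ η : Ordinal.{v}, ∃ g : C({x // r x = η}, ℝ), ∀ x, g x ∈ Metric.ball (f x.1) ε := by
    intro η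
    refine exists_continuous_forall_mem_convex_of_local_const (t := fun x : {x // r x = η} =>
      Metric.ball (f x.1) ε) (fun x => convex_ball _ _) ?_
    rintro ⟨x, hx⟩
    refine ⟨f x, ?_⟩
    have := (continuous_subtype_val.tendsto (⟨x, hx⟩ : {x // r x = η})).eventually (hr x)
    filter_upwards [this] with y hy
    rw [Metric.mem_ball, dist_comm, Real.dist_eq]
    exact hy.2 (y.2.trans hx.symm)
  choose G hG using key
  refine ⟨fun x => G (r x) ⟨x, rfl⟩, ?_, ?_⟩
  · intro x δ hδ
    have h1 := (G (r x)).continuous.tendsto ⟨x, rfl⟩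
    have h2 := Metric.tendsto_nhds.1 h1 δ hδ
    rw [nhds_subtype_eq_comap, eventually_comap] at h2
    filter_upwards [h2, hr x] with y hy hy2
    refine ⟨hy2.1, fun he => ?_⟩
    have := hy ⟨y, he⟩ rfl
    rw [Real.dist_eq] at this
    have hcong : ∀ η (hη : r y = η), G (r y) ⟨y, rfl⟩ = G η ⟨y, hη⟩ := by
      rintro _ rfl
      rfl
    rw [hcong _ he]
    exact this
  · intro x
    have := hG (r x) ⟨x, rfl⟩
    rw [Metric.mem_ball, Real.dist_eq] at this
    exact this.le

theorem LC_decomp (h : K → ℝ) (t : K → Ordinal.{v}) (hLC : LC h t) (a γ : Ordinal.{v})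
    (ht : ∀ x, t x < ω ^ (a + γ)) (S : Set ℝ) (hS : S.OrdConnected) (hS0 : (0 : ℝ) ∈ S)
    (hSh : ∀ x, h x ∈ S) :
    ∃ H : ℕ → K → ℝ, ∃ q : K → Ordinal.{v}, (∀ x, q x < ω ^ γ) ∧
      (∀ n, ∃ s : K → Ordinal.{v}, (∀ x, s x < ω ^ a) ∧ LC (H n) s) ∧
      (∀ n x, H n x ∈ S) ∧
      ∀ x, ∃ m : ℕ, ∀ᶠ y in 𝓝 x, q y ≤ q x ∧ (q y = q x → ∀ n ≥ m, H n y = h y) := by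
  classical
  have ha : (ω ^ a : Ordinal.{v}) ≠ 0 := (opow_pos _ omega0_pos).ne'
  let q : K → Ordinal.{v} := fun x => t x / ω ^ a
  let s : K → Ordinal.{v} := fun x => t x % ω ^ a
  have hts : ∀ x, ω ^ a * q x + s x = t x := fun x => div_add_mod _ _
  have hq : ∀ x, q x < ω ^ γ := by
    intro x
    rw [← Ordinal.lt_mul_iff_div_lt ha, ← opow_add]
    exact ht x
  have hs : ∀ x, s x < ω ^ a := fun x => mod_lt _ ha
  have hqu : ∀ x, ∀ᶠ y in 𝓝 x, q y ≤ q x := by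
    intro x
    filter_upwards [hLC x 1 one_pos] with y hy
    exact Ordinal.div_le_left hy.1 _
  let D : ℕ → Set K := fun n => {x | ∀ y, q x < q y → 1 / ((n : ℝ) + 1) ≤ dist x y}
  have hpos : ∀ n : ℕ, 0 < 1 / ((n : ℝ) + 1) := fun n => Nat.one_div_pos_of_nat
  have hDc : ∀ n, IsClosed (D n) := by
    intro n
    rw [← isOpen_compl_iff, isOpen_iff_mem_nhds]
    intro x hx
    have hx' : ∃ y, q x < q y ∧ dist x y < 1 / ((n : ℝ) + 1) := by
      by_contra hc
      push Not at hc
      exact hx hc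
    obtain ⟨y, hy, hd⟩ := hx'
    have hc : ∀ᶠ z in 𝓝 x, dist z y < 1 / ((n : ℝ) + 1) :=
      (continuous_id.dist continuous_const).continuousAt.eventually (gt_mem_nhds hd) 
    filter_upwards [hqu x, hc] with z hz hz2 hzD
    exact absurd (hzD y (hz.trans_lt hy)) (not_le.2 hz2)
  have hDq : ∀ n, ∀ x ∈ D n, ∀ y ∈ D n, dist x y < 1 / ((n : ℝ) + 1) → q y = q x := by
    intro n x hx y hy hd
    rcases lt_trichotomy (q x) (q y) with hlt | heq | hlt
    · exact absurd (hx y hlt) (not_le.2 hd)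
    · exact heq.symm
    · rw [dist_comm] at hd
      exact absurd (hy x hlt) (not_le.2 hd)
  have hDev : ∀ x, ∃ m : ℕ, ∀ᶠ y in 𝓝 x, q y ≤ q x ∧ (q y = q x → ∀ n ≥ m, y ∈ D n) := by
    intro x
    obtain ⟨δ, hδ, hδq⟩ := Metric.eventually_nhds_iff.1 (hqu x)
    obtain ⟨m, hm⟩ := exists_nat_one_div_lt (half_pos hδ)
    refine ⟨m, ?_⟩
    filter_upwards [Metric.ball_mem_nhds x (half_pos hδ), hqu x] with y hy hyq
    refine ⟨hyq, fun he n hn z hz => ?_⟩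
    have h1 : ¬ dist z x < δ := by
      intro hc
      have := hδq hc
      rw [he] at hz
      exact absurd hz (not_lt.2 this)
    rw [Metric.mem_ball] at hy
    have h2 : dist z x ≤ dist y z + dist y x := by
      rw [dist_comm y z]; exact dist_triangle _ _ _
    have h3 : 1 / ((n : ℝ) + 1) ≤ 1 / ((m : ℝ) + 1) := by
      apply one_div_le_one_div_of_le (by positivity)
      have : (m : ℝ) ≤ n := by exact_mod_cast hn
      linarith
    linarith
  have hloc : ∀ n, ∀ x ∈ D n, ∀ δ > 0, ∀ᶠ y in 𝓝 x, y ∈ D n →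
      s y ≤ s x ∧ (s y = s x → |h y - h x| < δ) := by
    intro n x hx δ hδ
    filter_upwards [hLC x δ hδ, Metric.ball_mem_nhds x (hpos n)] with y hy hyb hyD
    rw [Metric.mem_ball, dist_comm] at hyb
    have heq := hDq n x hx y hyD hyb
    constructor
    · have := hy.1
      rw [← hts y, ← hts x, heq] at this
      exact le_of_add_le_add_left this
    · intro hse
      apply hy.2
      rw [← hts y, ← hts x, heq, hse]
  have fin : ∀ H : ℕ → K → ℝ, (∀ n, ∀ x ∈ D n, H n x = h x) →
      ∀ x, ∃ m : ℕ, ∀ᶠ y in 𝓝 x, q y ≤ q x ∧ (q y = q x → ∀ n ≥ m, H n y = h y) := by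
    intro H hH x
    obtain ⟨m, hm⟩ := hDev x
    refine ⟨m, ?_⟩
    filter_upwards [hm] with y hy
    exact ⟨hy.1, fun he n hn => hH n y (hy.2 he n hn)⟩
  rcases eq_or_ne a 0 with rfl | ha0
  · have hs0 : ∀ x, s x = 0 := by
      intro x
      have := hs x
      rwa [opow_zero, Order.lt_one_iff] at this
    have ext : ∀ n, ∃ G : C(K, ℝ), (∀ x, G x ∈ S) ∧ ∀ x ∈ D n, G x = h x := by
      intro n
      have hcont : Continuous (fun x : D n => h x.1) := by
        rw [continuous_iff_continuousAt]
        rintro ⟨x, hx⟩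
        rw [ContinuousAt, Metric.tendsto_nhds]
        intro δ hδ
        have := (continuous_subtype_val.tendsto (⟨x, hx⟩ : D n)).eventually (hloc n x hx δ hδ)
        filter_upwards [this] with y hy
        rw [Real.dist_eq]
        exact (hy y.2).2 (by rw [hs0, hs0])
      obtain ⟨G, hG, hG2⟩ := ContinuousMap.exists_restrict_eq_forall_mem_of_closed
        (⟨fun x : D n => h x.1, hcont⟩ : C(D n, ℝ)) (t := S) (fun x => hSh _) ⟨0, hS0⟩ (hDc n)
      refine ⟨G, hG, fun x hx => ?_⟩
      exact DFunLike.congr_fun hG2 (⟨x, hx⟩ : D n)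
    choose G hG1 hG2 using ext
    refine ⟨fun n => G n, q, hq, fun n => ⟨fun _ => 0, fun x => by simp, ?_⟩, hG1, fin _ hG2⟩
    intro x δ hδ
    have := Metric.tendsto_nhds.1 ((G n).continuous.tendsto x) δ hδ
    filter_upwards [this] with y hy
    rw [Real.dist_eq] at hy
    exact ⟨le_rfl, fun _ => hy⟩
  · have h1a : (1 : Ordinal.{v}) < ω ^ a := Ordinal.one_lt_opow.2 ⟨one_lt_omega0, ha0⟩
    refine ⟨fun n => (D n).indicator h, q, hq, fun n => ⟨fun x => if x ∈ D n then 1 + s x else 0,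
      fun x => ?_, ?_⟩, ?_, ?_⟩
    · dsimp only
      split_ifs
      · exact isPrincipal_add_omega0_opow a h1a (hs x)
      · exact opow_pos _ omega0_pos
    · intro x δ hδ
      by_cases hx : x ∈ D n
      · filter_upwards [hloc n x hx δ hδ] with y hy
        by_cases hyD : y ∈ D n
        · simp only [hx, hyD, if_true, indicator_of_mem]
          refine ⟨by gcongr; exact (hy hyD).1, fun he => (hy hyD).2 (add_left_cancel he)⟩
        · simp only [hx, hyD, if_true, if_false]
          refine ⟨zero_le, fun he => ?_⟩
          have : (0 : Ordinal.{v}) < 1 + s x := zero_lt_one.trans_le le_self_add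
          exact absurd he this.ne
      · filter_upwards [(hDc n).isOpen_compl.mem_nhds hx] with y hy
        have hy' : y ∉ D n := hy
        simp [hx, hy', hδ]
    · intro n x
      by_cases hx : x ∈ D n
      · simp only [hx, indicator_of_mem]; exact hSh x
      · simpa [hx] using hS0
    · exact fin _ fun n x hx => by simp [hx]

theorem LC.baireOne {h : K → ℝ} {t : K → Ordinal.{v}} {a : Ordinal.{v}} (H : LC h t)
    (ht : ∀ x, t x < ω ^ a) : BaireOne h := by
  obtain ⟨F, q, _, hs, _, hF⟩ := LC_decomp h t H 0 a (by simpa using ht) univ ordConnected_univ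
    trivial (fun _ => trivial)
  refine ⟨F, fun n => ?_, fun x => ?_⟩
  · obtain ⟨s, hs0, hs⟩ := hs n
    have hs0' : ∀ x, s x = 0 := by
      intro x
      have := hs0 x
      rwa [opow_zero, Order.lt_one_iff] at this
    rw [continuous_iff_continuousAt]
    intro x
    rw [ContinuousAt, Metric.tendsto_nhds]
    intro δ hδ
    filter_upwards [hs x δ hδ] with y hy
    rw [Real.dist_eq]
    exact hy.2 (by rw [hs0', hs0'])
  · obtain ⟨m, hm⟩ := hF x
    have := hm.self_of_nhds.2 rfl
    refine tendsto_const_nhds.congr' ?_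
    filter_upwards [eventually_ge_atTop m] with n hn
    exact (this n hn).symm

end Metric

theorem sum_tail_bound (E : ℕ → ℝ) (hE : ∀ k, |E (k + 1)| ≤ 2 * (1 / 2) ^ k) (N n : ℕ)
    (h : N ≤ n) : |∑ k ∈ Finset.range (n + 1), E k - ∑ k ∈ Finset.range (N + 1), E k|
      ≤ 4 * (1 / 2) ^ N - 4 * (1 / 2) ^ n := by
  induction n, h using Nat.le_induction with
  | base => simp
  | succ n hn IH =>
    rw [Finset.sum_range_succ]
    have h1 := abs_le.1 IH
    have h2 := abs_le.1 (hE n)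
    rw [pow_succ (1 / 2 : ℝ) n, abs_le]
    constructor <;> linarith

theorem statement11 {K : Type*} [MetricSpace K] [CompactSpace K]
    (f : K → ℝ) (hf : BaireOne f) (β₀ γ₀ : Ordinal)
    (hβ₀1 : 1 ≤ β₀) (hβ₀ : β₀ < (Cardinal.aleph 1).ord) (hγ₀ : γ₀ < (Cardinal.aleph 1).ord)
    (hβ : beta f ≤ β₀ * Ordinal.omega0 ^ γ₀) :
    ∃ F : ℕ → K → ℝ, (∀ n, BaireOne (F n)) ∧
      (∀ x, Tendsto (fun n => F n x) atTop (nhds (f x))) ∧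
      (∀ n, beta (F n) ≤ β₀) ∧ gamma F ≤ Ordinal.omega0 ^ γ₀ := by
  rcases eq_or_ne γ₀ 0 with rfl | hγ0
  · refine ⟨fun _ => f, fun _ => hf, fun x => tendsto_const_nhds, fun _ => by simpa using hβ, ?_⟩
    refine gamma_le _ _ fun ε hε => ⟨fun _ => 0, fun x => by simp, fun x => ⟨0, ?_⟩⟩
    refine Eventually.of_forall fun y => ⟨le_rfl, fun _ n₁ _ n₂ _ => ?_⟩
    simpa using hε
  obtain ⟨a, ha1, ha2⟩ := exists_opow_le β₀ γ₀ hβ₀1 hγ0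
  have hωlt : Ordinal.omega0 < (Cardinal.aleph 1).ord := by
    rw [← Cardinal.ord_aleph0, Cardinal.ord_lt_ord, ← Cardinal.aleph_zero, Cardinal.aleph_lt_aleph]
    exact zero_lt_one
  have hinf : Cardinal.aleph0 ≤ Cardinal.aleph 1 := Cardinal.aleph0_le_aleph 1
  have hcount : β₀ * Ordinal.omega0 ^ γ₀ < (Cardinal.aleph 1).ord :=
    isPrincipal_mul_ord hinf hβ₀ (isPrincipal_opow_ord hinf hωlt hγ₀)
  have hg : ∀ k : ℕ, ∃ g : K → ℝ, ∃ r : K → Ordinal, (∀ x, r x < ω ^ (a + γ₀)) ∧ LC g r ∧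
      ∀ x, |g x - f x| ≤ (1 / 2) ^ k := by
    intro k
    obtain ⟨r, hr, hr2⟩ := exists_osc_rank f _ hcount hβ ((1 / 2) ^ k) (by positivity)
    obtain ⟨g, hg1, hg2⟩ := exists_LC_approx f _ r hr2
    exact ⟨g, r, fun x => (hr x).trans_le ha2, hg1, hg2⟩
  choose g r hr hgLC hgf using hg
  have hh : ∀ k : ℕ, ∃ h : K → ℝ, ∃ t : K → Ordinal, ∃ S : Set ℝ,
      h = (fun x => g k x - (if k = 0 then 0 else g (k - 1) x)) ∧
      LC h t ∧ (∀ x, t x < ω ^ (a + γ₀)) ∧ S.OrdConnected ∧ (0 : ℝ) ∈ S ∧ (∀ x, h x ∈ S) ∧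
      (∀ j, k = j + 1 → ∀ z ∈ S, |z| ≤ 2 * (1 / 2) ^ j) := by
    intro k
    rcases k with _ | k
    · exact ⟨g 0, r 0, univ, by simp, hgLC 0, hr 0, ordConnected_univ, trivial, fun _ => trivial,
        fun j hj => by omega⟩
    · refine ⟨fun x => g (k + 1) x + - g k x, fun x => hsum (r (k + 1) x) (r k x),
        Icc (-(2 * (1 / 2) ^ k)) (2 * (1 / 2) ^ k), by simp [sub_eq_add_neg],
        (hgLC (k + 1)).add (hgLC k).neg, fun x => hsum_lt _ _ (hr _ x) _ (hr _ x),
        ordConnected_Icc, ?_, ?_, ?_⟩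
      · rw [mem_Icc]
        have : (0 : ℝ) < (1 / 2) ^ k := by positivity
        constructor <;> linarith
      · intro x
        have h1 := abs_le.1 (hgf (k + 1) x)
        have h2 := abs_le.1 (hgf k x)
        rw [pow_succ] at h1
        have : (0 : ℝ) < (1 / 2) ^ k := by positivity
        rw [mem_Icc]
        constructor <;> linarith
      · intro j hj z hz
        obtain rfl : k = j := by omega
        exact abs_le.2 hz
  choose h t S hhdef hhLC hht hSo hS0 hSh hSb using hh
  have htel : ∀ N x, ∑ k ∈ Finset.range (N + 1), h k x = g N x := by
    intro N x
    induction N with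
    | zero => simp [hhdef]
    | succ N IH => rw [Finset.sum_range_succ, IH, hhdef]; simp
  have hdec := fun k => LC_decomp (h k) (t k) (hhLC k) a γ₀ (hht k) (S k) (hSo k) (hS0 k) (hSh k)
  choose H q hq hHs hHS hHq using hdec
  let F : ℕ → K → ℝ := fun n x => ∑ k ∈ Finset.range (n + 1), H k n x
  have hFLC : ∀ n N, ∃ s : K → Ordinal, (∀ x, s x < ω ^ a) ∧
      LC (fun x => ∑ k ∈ Finset.range (N + 1), H k n x) s := by
    intro n N
    induction N with
    | zero => simpa using hHs 0 n
    | succ N IH =>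
      obtain ⟨s, hs, hs2⟩ := IH
      obtain ⟨s', hs', hs2'⟩ := hHs (N + 1) n
      refine ⟨fun x => hsum (s x) (s' x), fun x => hsum_lt _ _ (hs x) _ (hs' x), ?_⟩
      simp only [Finset.sum_range_succ _ (N + 1)]
      exact hs2.add hs2'
  have hFq : ∀ N : ℕ, ∃ Q : K → Ordinal, (∀ x, Q x < ω ^ γ₀) ∧ ∀ x, ∃ m : ℕ, ∀ᶠ y in 𝓝 x,
      Q y ≤ Q x ∧ (Q y = Q x → ∀ k ≤ N, ∀ n ≥ m, H k n y = h k y) := by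
    intro N
    induction N with
    | zero =>
      refine ⟨q 0, hq 0, fun x => ?_⟩
      obtain ⟨m, hm⟩ := hHq 0 x
      refine ⟨m, hm.mono fun y hy => ⟨hy.1, fun he k hk => ?_⟩⟩
      obtain rfl : k = 0 := by omega
      exact hy.2 he
    | succ N IH =>
      obtain ⟨Q, hQ, hQ2⟩ := IH
      refine ⟨fun x => hsum (Q x) (q (N + 1) x), fun x => hsum_lt _ _ (hQ x) _ (hq _ x),
        fun x => ?_⟩
      obtain ⟨m, hm⟩ := hQ2 x
      obtain ⟨m', hm'⟩ := hHq (N + 1) x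
      refine ⟨max m m', ?_⟩
      filter_upwards [hm, hm'] with y hy hy'
      refine ⟨hsum_mono hy.1 hy'.1, fun he k hk n hn => ?_⟩
      obtain ⟨e1, e2⟩ := hsum_eq hy.1 hy'.1 he
      rcases Nat.le_succ_iff.1 hk with hk | rfl
      · exact hy.2 e1 k hk n ((le_max_left _ _).trans hn)
      · exact hy'.2 e2 n ((le_max_right _ _).trans hn)
  have hest : ∀ N n y, N ≤ n → (∀ k ≤ N, H k n y = h k y) →
      |F n y - g N y| ≤ 4 * (1 / 2) ^ N := by
    intro N n y hNn hk
    have h1 := sum_tail_bound (fun k => H k n y)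
      (fun k => hSb (k + 1) k rfl _ (hHS (k + 1) n y)) N n hNn
    have h2 : ∑ k ∈ Finset.range (N + 1), H k n y = g N y := by
      rw [← htel N y]
      exact Finset.sum_congr rfl fun k hk' => hk k (by rw [Finset.mem_range] at hk'; omega)
    rw [h2] at h1
    have : (0 : ℝ) < (1 / 2) ^ n := by positivity
    change |∑ k ∈ Finset.range (n + 1), H k n y - g N y| ≤ _
    linarith
  have hsmall : ∀ ε > (0 : ℝ), ∃ N : ℕ, 9 * (1 / 2 : ℝ) ^ N < ε := by
    intro ε hε
    obtain ⟨N, hN⟩ := exists_pow_lt_of_lt_one (show (0 : ℝ) < ε / 9 by positivity)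
      (show (1 / 2 : ℝ) < 1 by norm_num)
    exact ⟨N, by linarith⟩
  refine ⟨F, fun n => ?_, fun x => ?_, fun n => ?_, ?_⟩
  · obtain ⟨s, hs, hs2⟩ := hFLC n n
    exact hs2.baireOne hs
  · rw [Metric.tendsto_atTop]
    intro ε hε
    obtain ⟨N, hN⟩ := hsmall ε hε
    obtain ⟨Q, _, hQ⟩ := hFq N
    obtain ⟨m, hm⟩ := hQ x
    refine ⟨max N m, fun n hn => ?_⟩
    have h1 := abs_le.1 (hest N n x ((le_max_left _ _).trans hn) fun k hk =>
      hm.self_of_nhds.2 rfl k hk n ((le_max_right _ _).trans hn))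
    have h2 := abs_le.1 (hgf N x)
    have : (0 : ℝ) < (1 / 2) ^ N := by positivity
    rw [Real.dist_eq, abs_lt]
    constructor <;> linarith
  · obtain ⟨s, hs, hs2⟩ := hFLC n n
    exact (beta_le _ _ fun ε hε => ⟨s, hs, fun x => hs2 x ε hε⟩).trans ha1
  · refine gamma_le _ _ fun ε hε => ?_
    obtain ⟨N, hN⟩ := hsmall ε hε
    obtain ⟨Q, hQlt, hQ⟩ := hFq N
    refine ⟨Q, hQlt, fun x => ?_⟩
    obtain ⟨m, hm⟩ := hQ x
    refine ⟨max N m, ?_⟩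
    filter_upwards [hm] with y hy
    refine ⟨hy.1, fun he n₁ hn₁ n₂ hn₂ => ?_⟩
    have h1 := abs_le.1 (hest N n₁ y ((le_max_left _ _).trans hn₁.le) fun k hk =>
      hy.2 he k hk n₁ ((le_max_right _ _).trans hn₁.le))
    have h2 := abs_le.1 (hest N n₂ y ((le_max_left _ _).trans hn₂.le) fun k hk =>
      hy.2 he k hk n₂ ((le_max_right _ _).trans hn₂.le))
    have : (0 : ℝ) < (1 / 2) ^ N := by positivity
    rw [abs_lt]
    constructor <;> linarith
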